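/- (Green–Ruzsa, case (b)) Let G be a finite abelian group of order n > 1. If no prime congruent to 2 modulo 3 divides n, but 3 divides n, then α(G) = n/3. -/

import Mathlib

/-- A subset `S` of a group is product-free if there are no `a, b, c ∈ S`
(not necessarily distinct) with `a * b = c`. -/
def IsProductFree {G : Type*} [Group G] (S : Finset G) : Prop :=
  ∀ a ∈ S, ∀ b ∈ S, ∀ c ∈ S, a * b ≠ c

/-- `α(G)`: the largest cardinality of a product-free subset of `G`. -/
noncomputable def alphaPF (G : Type*) [Group G] [Fintype G] : ℕ :=
  sSup {k | ∃ S : Finset G, IsProductFree S ∧ S.card = k}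

open scoped Pointwise
open MulAction (stabilizer)

theorem mem_stabilizer_coe_iff {G : Type*} [CommGroup G] {C : Finset G} {g : G} :
    g ∈ stabilizer G (C : Set G) ↔ ∀ x, g * x ∈ C ↔ x ∈ C :=
  MulAction.mem_stabilizer_set

section Kneser

variable {G : Type*} [CommGroup G] [Fintype G]

theorem card_mul_card_le_card_inf_mul_card_image [DecidableEq G] (H K : Subgroup G) (x : G)
    (P Q : Finset G) (hP : ∀ p ∈ P, p ∈ H) (hQ : ∀ q ∈ Q, q ∈ K) :
    P.card * Q.card ≤
      Nat.card ↥(H ⊓ K) * ((P ×ˢ Q).image fun z => z.1 * z.2 * x).card := by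
  classical
  rw [← Finset.card_product]
  refine Finset.card_le_mul_card_image _ _ fun y hy => ?_
  obtain ⟨⟨p, q⟩, hpq, rfl⟩ := Finset.mem_image.1 hy
  obtain ⟨hp, hq⟩ := Finset.mem_product.1 hpq
  have hcard : Nat.card ↥(H ⊓ K) = (Finset.univ.filter (· ∈ H ⊓ K)).card := by
    rw [Nat.card_eq_fintype_card, Fintype.card_subtype]
  rw [hcard]
  have key : ∀ z ∈ (P ×ˢ Q).filter (fun z => z.1 * z.2 * x = p * q * x),
      z.1 ∈ P ∧ z.2 ∈ Q ∧ z.1 * z.2 = p * q := by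
    intro z hz
    simpa [and_assoc] using hz
  refine Finset.card_le_card_of_injOn (fun z => z.1 * p⁻¹) ?_ ?_
  · intro z hz
    obtain ⟨h1, h2, h3⟩ := key z hz
    have h4 : z.1 * p⁻¹ = q * z.2⁻¹ := by
      rw [mul_inv_eq_iff_eq_mul, mul_right_comm, eq_mul_inv_iff_mul_eq, h3, mul_comm]
    simp only [Finset.coe_filter, Finset.mem_univ, true_and, Set.mem_ofPred_eq]
    refine ⟨H.mul_mem (hP _ h1) (H.inv_mem (hP _ hp)), ?_⟩
    change z.1 * p⁻¹ ∈ K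
    rw [h4]
    exact K.mul_mem (hQ _ hq) (K.inv_mem (hQ _ h2))
  · intro z hz w hw hzw
    obtain ⟨-, -, h3⟩ := key z hz
    obtain ⟨-, -, h4⟩ := key w hw
    have h1 : z.1 = w.1 := mul_right_cancel hzw
    refine Prod.ext h1 ?_
    rw [← h4, h1] at h3
    exact mul_left_cancel h3

theorem Subgroup.card_le_card_of_forall_mul_mem (K : Subgroup G) (P : Finset G) {p : G}
    (hp : p ∈ P) (hK : ∀ k ∈ K, ∀ x ∈ P, k * x ∈ P) : Nat.card K ≤ P.card := by
  rw [← Nat.card_eq_finsetCard]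
  exact Nat.card_le_card_of_injective (fun k : K => (⟨k * p, hK k k.2 p hp⟩ : P))
    fun a b hab => Subtype.ext (mul_right_cancel (congrArg Subtype.val hab))

/-- If `C` is a union of cosets of `H` and `D` is a union of cosets of `K`, then `D \ C` and `C \ D`
cannot both be small: count inside a single coset of `H ⊔ K` meeting `D \ C`. -/
theorem card_sdiff_of_nonempty_sdiff [DecidableEq G] {C D : Finset G} (hne : (D \ C).Nonempty)
    (H K : Subgroup G) (hH : ∀ h ∈ H, ∀ y, h * y ∈ C ↔ y ∈ C)
    (hK : ∀ k ∈ K, ∀ y, k * y ∈ D ↔ y ∈ D) :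
    Nat.card H ≤ (D \ C).card + Nat.card ↥(H ⊓ K) ∨
      Nat.card K ≤ (C \ D).card + Nat.card ↥(H ⊓ K) ∨ Nat.card K ≤ (D \ C).card := by
  classical
  obtain ⟨x, hx⟩ := hne
  obtain ⟨hxD, hxC⟩ := Finset.mem_sdiff.1 hx
  let P := Finset.univ.filter fun g => g ∈ H ∧ g * x ∈ D
  let P' := Finset.univ.filter fun g => g ∈ H ∧ g * x ∉ D
  let Q := Finset.univ.filter fun g => g ∈ K ∧ g * x ∉ C
  let Q' := Finset.univ.filter fun g => g ∈ K ∧ g * x ∈ C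
  have hPP : P.card + P'.card = Nat.card H := by
    rw [Nat.card_eq_fintype_card, Fintype.card_subtype,
      ← Finset.card_filter_add_card_filter_not (s := Finset.univ.filter (· ∈ H))
        (fun g => g * x ∈ D), Finset.filter_filter,
      Finset.filter_filter]
  have hQQ : Q'.card + Q.card = Nat.card K := by
    rw [Nat.card_eq_fintype_card, Fintype.card_subtype,
      ← Finset.card_filter_add_card_filter_not (s := Finset.univ.filter (· ∈ K))
        (fun g => g * x ∈ C), Finset.filter_filter,
      Finset.filter_filter]
  have hP : Nat.card ↥(H ⊓ K) ≤ P.card := by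
    refine (H ⊓ K).card_le_card_of_forall_mul_mem P (p := 1) (by simp [P, hxD, H.one_mem]) ?_
    intro k hk y hy
    simp only [P, Finset.mem_filter, Finset.mem_univ, true_and] at hy ⊢
    exact ⟨H.mul_mem hk.1 hy.1, by rw [mul_assoc, hK k hk.2]; exact hy.2⟩
  have hQ : Nat.card ↥(H ⊓ K) ≤ Q.card := by
    refine (H ⊓ K).card_le_card_of_forall_mul_mem Q (p := 1) (by simp [Q, hxC, K.one_mem]) ?_
    intro k hk y hy
    simp only [Q, Finset.mem_filter, Finset.mem_univ, true_and] at hy ⊢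
    exact ⟨K.mul_mem hk.2 hy.1, by rw [mul_assoc, hH k hk.1]; exact hy.2⟩
  have hP' : P'.card = 0 ∨ Nat.card ↥(H ⊓ K) ≤ P'.card := by
    rcases P'.eq_empty_or_nonempty with h | ⟨p, hp⟩
    · exact Or.inl (by rw [h, Finset.card_empty])
    refine Or.inr ((H ⊓ K).card_le_card_of_forall_mul_mem P' hp ?_)
    intro k hk y hy
    simp only [P', Finset.mem_filter, Finset.mem_univ, true_and] at hy ⊢
    exact ⟨H.mul_mem hk.1 hy.1, by rw [mul_assoc, hK k hk.2]; exact hy.2⟩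
  have hQ' : Q'.card = 0 ∨ Nat.card ↥(H ⊓ K) ≤ Q'.card := by
    rcases Q'.eq_empty_or_nonempty with h | ⟨p, hp⟩
    · exact Or.inl (by rw [h, Finset.card_empty])
    refine Or.inr ((H ⊓ K).card_le_card_of_forall_mul_mem Q' hp ?_)
    intro k hk y hy
    simp only [Q', Finset.mem_filter, Finset.mem_univ, true_and] at hy ⊢
    exact ⟨K.mul_mem hk.2 hy.1, by rw [mul_assoc, hH k hk.1]; exact hy.2⟩
  have hE : P.card * Q.card ≤ Nat.card ↥(H ⊓ K) * (D \ C).card := by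
    refine (card_mul_card_le_card_inf_mul_card_image H K x P Q (by simp +contextual [P])
      (by simp +contextual [Q])).trans (Nat.mul_le_mul_left _ (Finset.card_le_card ?_))
    refine Finset.image_subset_iff.2 fun z hz => ?_
    simp only [P, Q, Finset.mem_product, Finset.mem_filter, Finset.mem_univ, true_and] at hz
    rw [Finset.mem_sdiff]
    refine ⟨?_, ?_⟩
    · rw [mul_comm z.1, mul_assoc, hK _ hz.2.1]; exact hz.1.2
    · rw [mul_assoc, hH _ hz.1.1]; exact hz.2.2
  have hF : P'.card * Q'.card ≤ Nat.card ↥(H ⊓ K) * (C \ D).card := by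
    refine (card_mul_card_le_card_inf_mul_card_image H K x P' Q' (by simp +contextual [P'])
      (by simp +contextual [Q'])).trans (Nat.mul_le_mul_left _ (Finset.card_le_card ?_))
    refine Finset.image_subset_iff.2 fun z hz => ?_
    simp only [P', Q', Finset.mem_product, Finset.mem_filter, Finset.mem_univ, true_and] at hz
    rw [Finset.mem_sdiff]
    refine ⟨?_, ?_⟩
    · rw [mul_assoc, hH _ hz.1.1]; exact hz.2.2
    · rw [mul_comm z.1, mul_assoc, hK _ hz.2.1]; exact hz.1.2
  have hpos : 0 < Nat.card ↥(H ⊓ K) := Nat.card_pos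
  rw [← hPP, ← hQQ]
  generalize Nat.card ↥(H ⊓ K) = h at *
  generalize P.card = p at *
  generalize Q.card = q at *
  generalize P'.card = p' at *
  generalize Q'.card = q' at *
  generalize (D \ C).card = e at *
  generalize (C \ D).card = f at *
  rcases hP' with rfl | hP'
  · left
    nlinarith
  rcases hQ' with rfl | hQ'
  · right; right
    nlinarith
  by_contra! hcon
  nlinarith

theorem card_add_card_stabilizer_union [DecidableEq G] {C D : Finset G} {N : ℕ}
    (hCD : ¬ C ⊆ D) (hDC : ¬ D ⊆ C)
    (hC : N ≤ C.card + Nat.card (stabilizer G (C : Set G)))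
    (hD : N ≤ D.card + Nat.card (stabilizer G (D : Set G))) :
    N ≤ (C ∪ D).card + Nat.card (stabilizer G ((C ∪ D : Finset G) : Set G)) := by
  have h₁ := card_sdiff_of_nonempty_sdiff (Finset.sdiff_nonempty.2 hDC) _ _
    (fun h => mem_stabilizer_coe_iff.1) (fun h => mem_stabilizer_coe_iff.1)
  have h₂ := card_sdiff_of_nonempty_sdiff (Finset.sdiff_nonempty.2 hCD) _ _
    (fun h => mem_stabilizer_coe_iff.1) (fun h => mem_stabilizer_coe_iff.1)
  rw [inf_comm] at h₂
  have hle : stabilizer G (C : Set G) ⊓ stabilizer G (D : Set G) ≤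
      stabilizer G ((C ∪ D : Finset G) : Set G) := by
    intro g hg
    have h₃ := mem_stabilizer_coe_iff.1 hg.1
    have h₄ := mem_stabilizer_coe_iff.1 hg.2
    exact mem_stabilizer_coe_iff.2 fun x => by simp [h₃, h₄]
  have hcard := Nat.card_le_card_of_injective _ (Subgroup.inclusion_injective hle)
  have h₅ : (D \ C).card + C.card = (C ∪ D).card := by
    rw [Finset.card_sdiff_add_card, Finset.union_comm]
  have h₆ : (C \ D).card + D.card = (C ∪ D).card := Finset.card_sdiff_add_card _ _
  omega

/-- Each element of a product set `A * B` lies in a subset of `A * B` satisfying the Kneser bound;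
the proof iterates the Dyson transform. -/
theorem exists_subset_mul_card_add_card_stabilizer [DecidableEq G] (n : ℕ) :
    ∀ (A B : Finset G), B.card ≤ n → ∀ a ∈ A, ∀ b ∈ B, ∃ C ⊆ A * B, a * b ∈ C ∧
      A.card + B.card ≤ C.card + Nat.card (stabilizer G (C : Set G)) := by
  induction n with
  | zero =>
    intro A B hB a _ b hb
    exact absurd hb (by simp [Finset.card_eq_zero.1 (Nat.le_zero.1 hB)])
  | succ n ih =>
    intro A B hB a ha b hb
    by_cases h : ∃ e ∈ A, ∃ c ∈ B, e * b⁻¹ * c ∉ A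
    · obtain ⟨e, he, c, hc, hec⟩ := h
      set t := Finset.mulDysonETransform (e * b⁻¹) (A, B) with ht
      have ht₁ : a ∈ t.1 := by simp [ht, Finset.mulDysonETransform, ha]
      have ht₂ : b ∈ t.2 := by
        refine Finset.mem_inter.2 ⟨hb, Finset.mem_inv_smul_finset_iff.2 ?_⟩
        simpa using he
      have hlt : t.2.card < B.card := by
        refine Finset.card_lt_card (Finset.ssubset_iff_subset_ne.2
          ⟨Finset.inter_subset_left, fun heq => hec ?_⟩)
        rw [← heq] at hc
        exact Finset.mem_inv_smul_finset_iff.1 (Finset.mem_inter.1 hc).2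
      obtain ⟨C, hC, hab, hcard⟩ := ih t.1 t.2 (by omega) a ht₁ b ht₂
      refine ⟨C, hC.trans (Finset.mulDysonETransform.subset _ _), hab, ?_⟩
      have := Finset.mulDysonETransform.card (e * b⁻¹) (A, B)
      simp only [← ht] at this
      omega
    · push Not at h
      have hAB : A.image (· * b) ⊆ A * B := Finset.image_subset_iff.2
        fun y hy => Finset.mul_mem_mul hy hb
      refine ⟨A.image (· * b), hAB, Finset.mem_image_of_mem _ ha, ?_⟩
      rw [Finset.card_image_of_injective _ (mul_left_injective b), add_le_add_iff_left,
        ← Nat.card_eq_finsetCard]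
      have hmem : ∀ c ∈ B, b⁻¹ * c ∈ stabilizer G ((A.image (· * b) : Finset G) : Set G) := by
        intro c hc
        refine (MulAction.mem_stabilizer_set' (Set.toFinite _)).2 fun y hy => ?_
        obtain ⟨e, he, rfl⟩ := Finset.mem_image.1 (Finset.mem_coe.1 hy)
        refine Finset.mem_coe.2 (Finset.mem_image.2 ⟨_, h e he c hc, ?_⟩)
        rw [smul_eq_mul, mul_assoc e, mul_comm e, mul_assoc]
      exact Nat.card_le_card_of_injective
        (fun c : B => (⟨b⁻¹ * c, hmem c c.2⟩ : stabilizer G ((A.image (· * b) : Finset G) : Set G)))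
        fun c d hcd => Subtype.ext (mul_left_cancel (congrArg Subtype.val hcd))

/-- **Kneser's theorem** for finite abelian groups. -/
theorem card_add_card_le_card_mul_add_card_stabilizer [DecidableEq G] {A B : Finset G}
    (hA : A.Nonempty) (hB : B.Nonempty) :
    A.card + B.card ≤ (A * B).card + Nat.card (stabilizer G ((A * B : Finset G) : Set G)) := by
  classical
  let F := (A * B).powerset.filter fun C : Finset G =>
    A.card + B.card ≤ C.card + Nat.card (stabilizer G (C : Set G))
  have hF : ∀ C : Finset G, C ∈ F ↔ C ⊆ A * B ∧
      A.card + B.card ≤ C.card + Nat.card (stabilizer G (C : Set G)) := by simp [F]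
  have hex : ∀ c ∈ A * B, ∃ C ∈ F, c ∈ C := by
    intro c hc
    obtain ⟨a, ha, b, hb, rfl⟩ := Finset.mem_mul.1 hc
    obtain ⟨C, h₁, h₂, h₃⟩ :=
      exists_subset_mul_card_add_card_stabilizer _ A B le_rfl a ha b hb
    exact ⟨C, (hF C).2 ⟨h₁, h₃⟩, h₂⟩
  obtain ⟨c, hc⟩ := hA.mul hB
  obtain ⟨C₀, hC₀, -⟩ := hex c hc
  obtain ⟨C, hC, hmax⟩ := F.exists_max_image Finset.card ⟨C₀, hC₀⟩
  obtain ⟨hsub, hcard⟩ := (hF C).1 hC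
  suffices A * B ⊆ C by rwa [hsub.antisymm this] at hcard
  intro c hc
  by_contra hcC
  obtain ⟨D, hD, hcD⟩ := hex c hc
  obtain ⟨hDsub, hDcard⟩ := (hF D).1 hD
  have hDC : ¬ D ⊆ C := fun h => hcC (h hcD)
  by_cases hCD : C ⊆ D
  · exact (hmax D hD).not_gt (Finset.card_lt_card ⟨hCD, hDC⟩)
  · refine (hmax (C ∪ D) ((hF _).2 ⟨Finset.union_subset hsub hDsub,
      card_add_card_stabilizer_union hCD hDC hcard hDcard⟩)).not_gt ?_
    exact Finset.card_lt_card ⟨Finset.subset_union_left,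
      fun h => hDC (Finset.subset_union_right.trans h)⟩

end Kneser

theorem Nat.exists_prime_dvd_mod_three_eq_two {m : ℕ} (hm : m % 3 = 2) :
    ∃ q : ℕ, q.Prime ∧ q % 3 = 2 ∧ q ∣ m := by
  induction m using Nat.strong_induction_on with
  | _ m ih =>
    have hm₁ : m ≠ 1 := by rintro rfl; simp at hm
    obtain ⟨p, hp, k, rfl⟩ := Nat.exists_prime_and_dvd hm₁
    by_cases hp₂ : p % 3 = 2
    · exact ⟨p, hp, hp₂, dvd_mul_right _ _⟩
    have hk : k % 3 = 2 := by
      rw [Nat.mul_mod] at hm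
      have h₁ := Nat.mod_lt p three_pos
      have h₂ := Nat.mod_lt k three_pos
      interval_cases p % 3 <;> interval_cases k % 3 <;> simp_all
    have hlt : k < p * k := by
      have := hp.two_le
      have : 0 < k := by omega
      nlinarith
    obtain ⟨q, hq, hq₂, hqk⟩ := ih k hlt hk
    exact ⟨q, hq, hq₂, hqk.mul_left p⟩

theorem Subgroup.card_dvd_card_of_forall_mul_mem {G : Type*} [CommGroup G] (H : Subgroup G)
    (T : Finset G) (hT : ∀ h ∈ H, ∀ x ∈ T, h * x ∈ T) : Nat.card H ∣ T.card := by
  have hpre : (QuotientGroup.mk ⁻¹' ((QuotientGroup.mk : G → G ⧸ H) '' T) : Set G) = T := by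
    refine Set.Subset.antisymm ?_ (Set.subset_preimage_image _ _)
    rintro x ⟨y, hy, hyx⟩
    have := hT _ (QuotientGroup.eq.1 hyx) y hy
    rwa [mul_comm, mul_inv_cancel_left] at this
  have h := Nat.card_congr (QuotientGroup.preimageMkEquivSubgroupProdSet H
    ((QuotientGroup.mk : G → G ⧸ H) '' T))
  rw [hpre, Nat.card_prod] at h
  rw [← Nat.card_eq_finsetCard]
  exact ⟨_, h⟩

/-- The upper bound: it follows from Kneser's theorem applied to the union of the cosets of the
stabilizer of `S * S` that meet `S`. -/
theorem IsProductFree.three_mul_card_le {G : Type*} [CommGroup G] [Fintype G]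
    (hno : ∀ q : ℕ, q.Prime → q % 3 = 2 → ¬ q ∣ Fintype.card G) {S : Finset G}
    (hS : IsProductFree S) : 3 * S.card ≤ Fintype.card G := by
  classical
  rcases S.eq_empty_or_nonempty with rfl | hne
  · simp
  set H := stabilizer G ((S * S : Finset G) : Set G) with hH
  have hHmem : ∀ h ∈ H, ∀ x, h * x ∈ S * S ↔ x ∈ S * S := fun h => mem_stabilizer_coe_iff.1
  let T := Finset.univ.filter fun x => ∃ h ∈ H, h * x ∈ S
  have hT : ∀ x, x ∈ T ↔ ∃ h ∈ H, h * x ∈ S := by simp [T]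
  have hST : S ⊆ T := fun x hx => (hT x).2 ⟨1, H.one_mem, by simpa using hx⟩
  have hTT : T * T = S * S := by
    refine Finset.Subset.antisymm (fun z hz => ?_) (Finset.mul_subset_mul hST hST)
    obtain ⟨x, hx, y, hy, rfl⟩ := Finset.mem_mul.1 hz
    obtain ⟨h, hh, hx⟩ := (hT x).1 hx
    obtain ⟨k, hk, hy⟩ := (hT y).1 hy
    rw [← hHmem (h * k) (H.mul_mem hh hk), mul_mul_mul_comm]
    exact Finset.mul_mem_mul hx hy
  have hdisj : Disjoint T (T * T) := by
    rw [hTT, Finset.disjoint_left]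
    intro x hx hxS
    obtain ⟨h, hh, hx⟩ := (hT x).1 hx
    obtain ⟨a, ha, b, hb, hab⟩ := Finset.mem_mul.1 ((hHmem h hh x).2 hxS)
    exact hS a ha b hb _ hx hab
  have hkneser := card_add_card_le_card_mul_add_card_stabilizer (hne.mono hST) (hne.mono hST)
  have hle : T.card + (T * T).card ≤ Fintype.card G := by
    rw [← Finset.card_union_of_disjoint hdisj]
    exact Finset.card_le_univ _
  have hdvd : Nat.card H ∣ T.card := by
    refine H.card_dvd_card_of_forall_mul_mem T fun h hh x hx => ?_
    obtain ⟨k, hk, hx⟩ := (hT x).1 hx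
    exact (hT _).2 ⟨k * h⁻¹, H.mul_mem hk (H.inv_mem hh), by simpa [mul_assoc] using hx⟩
  have hdvdG : Nat.card H ∣ Fintype.card G := by
    rw [← Nat.card_eq_fintype_card]
    exact H.card_subgroup_dvd_card
  have hpos : 0 < Nat.card H := Nat.card_pos
  refine (Nat.mul_le_mul_left 3 (Finset.card_le_card hST)).trans ?_
  rw [hTT, ← hH] at hkneser
  rw [hTT] at hle
  obtain ⟨t, ht⟩ := hdvd
  obtain ⟨m, hm⟩ := hdvdG
  have hm₂ : m % 3 ≠ 2 := fun h => by
    obtain ⟨q, hq, hq₂, hqm⟩ := Nat.exists_prime_dvd_mod_three_eq_two h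
    exact hno q hq hq₂ (hm ▸ hqm.mul_left _)
  have htm : Nat.card H * (3 * t) ≤ Nat.card H * (m + 1) := by
    rw [mul_add, ← hm, mul_left_comm, ← ht]
    omega
  have htm' := Nat.le_of_mul_le_mul_left htm hpos
  rw [ht, hm, mul_left_comm]
  exact Nat.mul_le_mul_left _ (by omega)

theorem CommGroup.exists_surjective_zmod_of_prime_dvd_card {G : Type*} [CommGroup G] [Finite G]
    {p : ℕ} (hp : p.Prime) (h : p ∣ Nat.card G) :
    ∃ f : G →* Multiplicative (ZMod p), Function.Surjective f := by
  classical
  obtain ⟨ι, _, n, -, ⟨e⟩⟩ := CommGroup.equiv_prod_multiplicative_zmod_of_finite G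
  have hcard : Nat.card G = ∏ i, n i := by
    rw [Nat.card_congr e.toEquiv, Nat.card_pi]
    exact Finset.prod_congr rfl fun i _ => Nat.card_zmod (n i)
  rw [hcard] at h
  obtain ⟨i, -, hi⟩ := (hp.prime.dvd_finsetProd_iff _).1 h
  refine ⟨((AddMonoidHom.toMultiplicative (ZMod.castHom hi (ZMod p)).toAddMonoidHom).comp
    (Pi.evalMonoidHom _ i)).comp e.toMonoidHom, ?_⟩
  have hcast : Function.Surjective
      (AddMonoidHom.toMultiplicative (ZMod.castHom hi (ZMod p)).toAddMonoidHom) :=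
    ZMod.castHom_surjective hi
  exact (hcast.comp (Function.surjective_eval i)).comp e.surjective

theorem exists_isProductFree_three_mul_card_eq {G : Type*} [CommGroup G] [Fintype G]
    (h3 : 3 ∣ Fintype.card G) :
    ∃ S : Finset G, IsProductFree S ∧ 3 * S.card = Fintype.card G := by
  classical
  obtain ⟨f, hf⟩ := CommGroup.exists_surjective_zmod_of_prime_dvd_card Nat.prime_three
    (by rwa [Nat.card_eq_fintype_card] : 3 ∣ Nat.card G)
  let w : Multiplicative (ZMod 3) := Multiplicative.ofAdd 1
  refine ⟨Finset.univ.filter fun g => f g = w, ?_, ?_⟩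
  · intro a ha b hb c hc habc
    simp only [Finset.mem_filter, Finset.mem_univ, true_and] at ha hb hc
    rw [← habc, map_mul, ha, hb] at hc
    exact absurd hc (by decide)
  · rw [← Finset.card_univ, Finset.card_eq_sum_card_fiberwise (s := Finset.univ) (f := f)
      (t := Finset.univ) (fun _ _ => Finset.mem_coe.2 (Finset.mem_univ _)),
      Finset.sum_congr rfl fun y _ => MonoidHom.card_fiber_eq_of_mem_range f (hf y) (hf w)]
    simp [ZMod.card]

/-- Green–Ruzsa, case (b): if `G` is a finite abelian group of order `n > 1`,
no prime `≡ 2 (mod 3)` divides `n`, but `3 ∣ n`, then `α(G) = n/3`. -/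
theorem green_ruzsa_case_b {G : Type*} [CommGroup G] [Fintype G]
    (hn : 1 < Fintype.card G)
    (hno : ∀ q : ℕ, q.Prime → q % 3 = 2 → ¬ q ∣ Fintype.card G)
    (h3 : 3 ∣ Fintype.card G) :
    (alphaPF G : ℚ) = Fintype.card G / 3 := by
  obtain ⟨S, hS, hcard⟩ := exists_isProductFree_three_mul_card_eq h3
  have halpha : alphaPF G = S.card := by
    refine IsGreatest.csSup_eq ⟨⟨S, hS, rfl⟩, ?_⟩
    rintro _ ⟨T, hT, rfl⟩
    have := hT.three_mul_card_le hno
    omega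
  rw [halpha, ← hcard]
  push_cast
  ring
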